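/- For every integer n ≥ 19, every n-vertex C4-free Halin graph H satisfies e(H) ≤ 5(n−1)/3 if n ≡ 1 (mod 3), e(H) ≤ 5(n−2)/3 + 1 if n ≡ 2 (mod 3), and e(H) ≤ 5(n−3)/3 + 3 if n ≡ 0 (mod 3). -/

import Mathlib

open SimpleGraph

/-- Degree of a vertex as the `ncard` of its neighbour set. -/
noncomputable def ncDeg {V : Type*} (G : SimpleGraph V) (v : V) : ℕ :=
  (G.neighborSet v).ncard

/-- A leaf is a vertex of degree one. -/
def IsLeaf {V : Type*} (G : SimpleGraph V) (v : V) : Prop :=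
  ncDeg G v = 1

/-- A Halin graph, presented by its characteristic tree `T` and outer cycle `C`.
The underlying graph is `T ⊔ C`.  The outer cycle is a `2`-regular connected graph
whose support is exactly the set of leaves of `T`, every non-leaf of `T` has degree
at least three, and the cycle is compatible with a planar embedding: for every edge
`uv` of `T`, the leaves lying in each component of `T - uv` are consecutive on the
cycle, i.e. they induce a connected subgraph of the cycle. -/
structure HalinGraph (V : Type*) [Fintype V] : Type _ where
  /-- the characteristic tree -/
  T : SimpleGraph V
  /-- the outer cycle -/
  C : SimpleGraph V
  tree_isTree : T.IsTree
  four_le_card : 4 ≤ Fintype.card V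
  nonleaf_degree : ∀ v : V, ¬ IsLeaf T v → 3 ≤ ncDeg T v
  support_C : C.support = {v : V | IsLeaf T v}
  two_regular : ∀ v ∈ C.support, ncDeg C v = 2
  cycle_connected : (C.induce C.support).Connected
  planar : ∀ u v : V, T.Adj u v →
    (C.induce {x : V | IsLeaf T x ∧ (T.deleteEdges {s(u, v)}).Reachable u x}).Connected

/-- The Halin graph itself: the (edge-disjoint) union of the tree and the outer cycle. -/
def HalinGraph.graph {V : Type*} [Fintype V] (H : HalinGraph V) : SimpleGraph V :=
  H.T ⊔ H.C

/-- Number of edges of a graph. -/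
noncomputable def eCount {V : Type*} (G : SimpleGraph V) : ℕ :=
  G.edgeSet.ncard

/-- A graph is `C₄`-free iff it contains no cycle of length `4`. -/
def C4Free {V : Type*} (G : SimpleGraph V) : Prop :=
  ∀ (v : V) (w : G.Walk v v), w.IsCycle → w.length ≠ 4

/-- A semi-branching vertex of the characteristic tree: a non-leaf with at least one
leaf neighbour and at least two non-leaf neighbours. -/
def SemiBranching {V : Type*} (T : SimpleGraph V) (v : V) : Prop :=
  ¬ IsLeaf T v ∧ (∃ x, T.Adj v x ∧ IsLeaf T x) ∧
    ∃ x y : V, x ≠ y ∧ T.Adj v x ∧ T.Adj v y ∧ ¬ IsLeaf T x ∧ ¬ IsLeaf T y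

/-- A `C₄`-free graph has no closed walk `a b c d a` with `a ≠ c` and `b ≠ d`. -/
lemma C4Free.not_adj_four {V : Type*} {G : SimpleGraph V} (hG : C4Free G) {a b c d : V}
    (hab : G.Adj a b) (hbc : G.Adj b c) (hcd : G.Adj c d) (hda : G.Adj d a)
    (hac : a ≠ c) (hbd : b ≠ d) : False := by
  refine hG a (.cons hab (.cons hbc (.cons hcd (.cons hda .nil)))) ?_ (by simp)
  rw [Walk.isCycle_def, Walk.isTrail_def]
  have h1 := hab.ne
  have h2 := hbc.ne
  have h3 := hcd.ne
  have h4 := hda.ne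
  refine ⟨?_, by simp, ?_⟩ <;> simp <;> grind

lemma IsLeaf.eq_of_adj {V : Type*} {G : SimpleGraph V} {a x y : V} (ha : IsLeaf G a)
    (hx : G.Adj a x) (hy : G.Adj a y) : x = y := by
  obtain ⟨z, hz⟩ := Set.ncard_eq_one.1 ha
  have h1 : x ∈ G.neighborSet a := hx
  have h2 : y ∈ G.neighborSet a := hy
  rw [hz] at h1 h2
  exact h1.trans h2.symm

lemma IsLeaf.exists_adj {V : Type*} {G : SimpleGraph V} {a : V} (ha : IsLeaf G a) :
    ∃ x, G.Adj a x := by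
  obtain ⟨z, hz⟩ := Set.ncard_eq_one.1 ha
  exact ⟨z, by rw [← mem_neighborSet, hz]; rfl⟩

/-- In a connected graph on at least three vertices, no two leaves are adjacent. -/
lemma IsLeaf.not_isLeaf_of_adj {V : Type*} [Fintype V] {G : SimpleGraph V} (hG : G.Connected)
    (hV : 3 ≤ Fintype.card V) {a b : V} (ha : IsLeaf G a) (hab : G.Adj a b) : ¬ IsLeaf G b := by
  classical
  intro hb
  have key : ∀ x y : V, G.Walk x y → y = a → x = a ∨ x = b := by
    intro x y w
    induction w with
    | nil => exact Or.inl
    | cons h p ih =>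
      intro hy
      rcases ih hy with rfl | rfl
      · exact Or.inr (ha.eq_of_adj h.symm hab)
      · exact Or.inl (hb.eq_of_adj h.symm hab.symm)
  have hsub : (Finset.univ : Finset V) ⊆ {a, b} := by
    intro x _
    obtain ⟨w⟩ := hG.preconnected x a
    simpa using key x a w rfl
  have := Finset.card_le_card hsub
  have := Finset.card_le_two (a := a) (b := b)
  rw [Finset.card_univ] at *
  omega

/-- After deleting an edge of a connected graph, every vertex is joined to one of its ends. -/
lemma SimpleGraph.Connected.reachable_deleteEdges_or {V : Type*} {G : SimpleGraph V}
    (hG : G.Connected) (u v x : V) :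
    (G.deleteEdges {s(u, v)}).Reachable u x ∨ (G.deleteEdges {s(u, v)}).Reachable v x := by
  obtain ⟨w⟩ := hG.preconnected x u
  have key : ∀ x y : V, G.Walk x y → y = u →
      (G.deleteEdges {s(u, v)}).Reachable u x ∨ (G.deleteEdges {s(u, v)}).Reachable v x := by
    intro x y w
    induction w with
    | nil => rintro rfl; exact Or.inl (Reachable.refl _)
    | @cons x z y h p ih =>
      intro hy
      by_cases he : s(x, z) = s(u, v)
      · rcases Sym2.eq_iff.1 he with ⟨rfl, -⟩ | ⟨rfl, -⟩
        · exact Or.inl (Reachable.refl _)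
        · exact Or.inr (Reachable.refl _)
      · have hz : (G.deleteEdges {s(u, v)}).Adj z x := by
          rw [deleteEdges_adj, Sym2.eq_swap (a := z)]
          exact ⟨h.symm, he⟩
        exact (ih hy).imp (fun h => h.trans hz.reachable) (fun h => h.trans hz.reachable)
  exact key x u w rfl

/-- In a tree, two distinct non-leaves `u`, `v` are separated by an edge at `u` whose other end
is not a leaf. -/
lemma exists_adj_separating {V : Type*} {T : SimpleGraph V} (hT : T.IsTree) {u v : V}
    (huv : u ≠ v) (hv : ¬ IsLeaf T v) :
    ∃ x, T.Adj u x ∧ ¬ IsLeaf T x ∧ ¬ (T.deleteEdges {s(u, x)}).Reachable u v := by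
  obtain ⟨p, hp⟩ := hT.connected.exists_isPath u v
  cases p with
  | nil => exact absurd rfl huv
  | @cons _ x _ h q =>
    rw [Walk.cons_isPath_iff] at hp
    refine ⟨x, h, ?_, ?_⟩
    · intro hx
      cases q with
      | nil => exact hv hx
      | @cons _ z _ h' r =>
        have : z = u := hx.eq_of_adj h' h.symm
        subst this
        simp at hp
    · intro hr
      have hq : (T.deleteEdges {s(u, x)}).Reachable x v :=
        ⟨q.toDeleteEdge _ fun he => hp.2 (q.fst_mem_support_of_mem_edges he)⟩
      have hb := isAcyclic_iff_forall_adj_isBridge.1 hT.isAcyclic h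
      exact (isBridge_iff.1 hb) (hr.trans hq.symm)

/-- The edges of `G` with both ends in a set inducing a connected subgraph are at least as many
as the vertices of that set, minus one. -/
lemma ncard_le_ncard_edges_of_connected_induce {V : Type*} [Fintype V] {G : SimpleGraph V}
    {S : Set V} (hS : (G.induce S).Connected) :
    S.ncard ≤ {e ∈ G.edgeSet | ∀ x ∈ e, x ∈ S}.ncard + 1 := by
  have h := hS.card_vert_le_card_edgeSet_add_one
  rw [Nat.card_coe_set_eq, Nat.card_coe_set_eq] at h
  refine h.trans (Nat.add_le_add_right ?_ 1)
  rw [← Set.ncard_image_of_injective _ (Sym2.map.injective (Subtype.val_injective (p := (· ∈ S))))]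
  refine Set.ncard_le_ncard ?_ (Set.toFinite _)
  rintro _ ⟨e, he, rfl⟩
  induction e with
  | _ x y =>
    simp only [mem_edgeSet, comap_adj, Function.Embedding.subtype_apply] at he
    simp [he]

namespace HalinGraph

variable {V : Type*} [Fintype V] (H : HalinGraph V)

/-- The set of leaves of the characteristic tree. -/
def leaves : Set V := {v | IsLeaf H.T v}

lemma isLeaf_of_adj_C {a b : V} (h : H.C.Adj a b) : IsLeaf H.T a := by
  have : a ∈ H.C.support := ⟨b, h⟩
  rwa [H.support_C] at this

lemma not_isLeaf_of_adj {a b : V} (ha : IsLeaf H.T a) (hab : H.T.Adj a b) : ¬ IsLeaf H.T b :=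
  ha.not_isLeaf_of_adj H.tree_isTree.connected (by have := H.four_le_card; omega) hab

lemma ncard_edgeSet_C : H.C.edgeSet.ncard = H.leaves.ncard := by
  classical
  have h := H.C.sum_degrees_eq_twice_card_edges
  have hd : ∀ v, H.C.degree v = if v ∈ H.leaves then 2 else 0 := by
    intro v
    have hs : v ∈ H.C.support ↔ v ∈ H.leaves := by rw [H.support_C]; rfl
    split_ifs with hv
    · rw [← H.two_regular v (hs.2 hv), ncDeg, Set.ncard_eq_toFinset_card']
      rfl
    · rw [← hs, mem_support] at hv
      rw [degree_eq_zero]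
      exact fun w hw => hv ⟨w, hw⟩
  simp only [hd, Finset.sum_ite, Finset.sum_const_zero, Finset.sum_const] at h
  rw [Set.ncard_eq_toFinset_card', Set.ncard_eq_toFinset_card']
  have h2 : (Finset.univ.filter (· ∈ H.leaves)) = H.leaves.toFinset := by ext; simp
  rw [h2] at h
  rw [edgeFinset] at h
  simp at h ⊢
  omega

/-- The tree edges joining two non-leaves. -/
def innerEdges : Set (Sym2 V) := {e ∈ H.T.edgeSet | ∀ x ∈ e, ¬ IsLeaf H.T x}

lemma ncard_edgeSet_T : H.T.edgeSet.ncard + 1 = Fintype.card V := by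
  classical
  rw [Set.ncard_eq_toFinset_card', ← H.tree_isTree.card_edgeFinset, edgeFinset]

lemma ncard_innerEdges_add_ncard_leaves_add_one_le :
    H.innerEdges.ncard + H.leaves.ncard + 1 ≤ Fintype.card V := by
  classical
  rw [← H.ncard_edgeSet_T]
  choose! p hp using fun a (ha : IsLeaf H.T a) => ha.exists_adj
  have hinj : Set.InjOn (fun a => s(a, p a)) H.leaves := by
    intro a ha b hb hab
    rcases Sym2.eq_iff.1 hab with ⟨h, -⟩ | ⟨h, -⟩
    · exact h
    · exact absurd ha (h ▸ H.not_isLeaf_of_adj hb (hp b hb))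
  rw [← hinj.ncard_image, ← Set.ncard_union_eq _ (Set.toFinite _) (Set.toFinite _)]
  · refine Nat.add_le_add_right (Set.ncard_le_ncard ?_ (Set.toFinite _)) 1
    rintro e (he | ⟨a, ha, rfl⟩)
    · exact he.1
    · exact hp a ha
  · rw [Set.disjoint_left]
    rintro _ he ⟨a, ha, rfl⟩
    exact he.2 a (by simp) ha

/-- Whether a tree edge `e` separates the ends of `f` in the characteristic tree. -/
def Separates (f e : Sym2 V) : Prop :=
  ∃ a b, f = s(a, b) ∧ ¬ (H.T.deleteEdges {e}).Reachable a b

/-- By planarity, every tree edge separates the ends of at most two cycle edges. -/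
lemma ncard_separates_le_two {e : Sym2 V} (he : e ∈ H.T.edgeSet) :
    {f ∈ H.C.edgeSet | H.Separates f e}.ncard ≤ 2 := by
  induction e with
  | _ u v =>
    set R := H.T.deleteEdges {s(u, v)} with hR
    set A : Set V := {x | IsLeaf H.T x ∧ R.Reachable u x} with hA
    set B : Set V := {x | IsLeaf H.T x ∧ R.Reachable v x} with hB
    have h1 : (H.C.induce A).Connected := H.planar u v he
    have h2 : (H.C.induce B).Connected := by
      have := H.planar v u (H.T.adj_symm he)
      rwa [Sym2.eq_swap] at this
    have hcA := ncard_le_ncard_edges_of_connected_induce h1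
    have hcB := ncard_le_ncard_edges_of_connected_induce h2
    set EA := {e ∈ H.C.edgeSet | ∀ x ∈ e, x ∈ A}
    set EB := {e ∈ H.C.edgeSet | ∀ x ∈ e, x ∈ B}
    set X := {f ∈ H.C.edgeSet | H.Separates f s(u, v)}
    have hdis : ∀ x, x ∈ A → x ∉ B := by
      intro x hx hx'
      have hb := isAcyclic_iff_forall_adj_isBridge.1 H.tree_isTree.isAcyclic he
      exact (isBridge_iff.1 hb) (hx.2.trans hx'.2.symm)
    have hleaves : H.leaves.ncard ≤ A.ncard + B.ncard := by
      refine le_trans (Set.ncard_le_ncard ?_ (Set.toFinite _)) (Set.ncard_union_le A B)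
      intro x hx
      exact (H.tree_isTree.connected.reachable_deleteEdges_or u v x).imp
        (fun h => ⟨hx, h⟩) (fun h => ⟨hx, h⟩)
    have hEAB : Disjoint EA EB := by
      rw [Set.disjoint_left]
      intro f hf hf'
      induction f with
      | _ a b => exact hdis a (hf.2 a (by simp)) (hf'.2 a (by simp))
    have hX : Disjoint (EA ∪ EB) X := by
      rw [Set.disjoint_left]
      rintro f hf ⟨-, a, b, rfl, hab⟩
      rcases hf with hf | hf
      · exact hab ((hf.2 a (by simp)).2.symm.trans (hf.2 b (by simp)).2)
      · exact hab ((hf.2 a (by simp)).2.symm.trans (hf.2 b (by simp)).2)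
    have hsum : EA.ncard + EB.ncard + X.ncard ≤ H.C.edgeSet.ncard := by
      rw [← Set.ncard_union_eq hEAB (Set.toFinite _) (Set.toFinite _),
        ← Set.ncard_union_eq hX (Set.toFinite _) (Set.toFinite _)]
      refine Set.ncard_le_ncard ?_ (Set.toFinite _)
      rintro f ((hf | hf) | hf) <;> exact hf.1
    rw [H.ncard_edgeSet_C] at hsum
    omega

/-- The cycle edges whose two ends hang from the same vertex of the tree. -/
def twinGraph : SimpleGraph V where
  Adj a b := H.C.Adj a b ∧ ∃ u, H.T.Adj a u ∧ H.T.Adj b u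
  symm := ⟨fun _ _ ⟨h, u, hu⟩ => ⟨h.symm, u, hu.symm⟩⟩
  loopless := ⟨fun _ h => h.1.ne rfl⟩

variable {H}

lemma two_mul_ncard_edgeSet_twinGraph_le (hfree : C4Free H.graph) :
    2 * H.twinGraph.edgeSet.ncard ≤ H.leaves.ncard := by
  classical
  have h := H.twinGraph.sum_degrees_eq_twice_card_edges
  have hd : ∀ v, H.twinGraph.degree v ≤ if v ∈ H.leaves then 1 else 0 := by
    intro b
    split_ifs with hb
    · rw [degree, Finset.card_le_one]
      intro a ha c hc
      rw [mem_neighborFinset] at ha hc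
      obtain ⟨hba, u, hbu, hau⟩ := ha
      obtain ⟨hbc, w, hbw, hcw⟩ := hc
      obtain rfl := hb.eq_of_adj hbu hbw
      by_contra hac
      exact hfree.not_adj_four (a := u) (b := a) (c := b) (d := c) (Or.inl hau.symm)
        (Or.inr hba.symm) (Or.inr hbc) (Or.inl hcw) hbu.ne' hac
    · rw [Nat.le_zero, degree_eq_zero]
      exact fun w hw => hb (H.isLeaf_of_adj_C hw.1)
  have hle := Finset.sum_le_sum fun v (_ : v ∈ Finset.univ) => hd v
  rw [h, ← Finset.card_filter] at hle
  rw [Set.ncard_eq_toFinset_card', Set.ncard_eq_toFinset_card']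
  have h2 : (Finset.univ.filter (· ∈ H.leaves)) = H.leaves.toFinset := by ext; simp
  rw [h2, edgeFinset] at hle
  exact hle

/-- A cycle edge whose ends have different tree neighbours is separated by two inner edges. -/
lemma two_le_ncard_separates (hfree : C4Free H.graph) {f : Sym2 V}
    (hf : f ∈ H.C.edgeSet \ H.twinGraph.edgeSet) :
    2 ≤ {e ∈ H.innerEdges | H.Separates f e}.ncard := by
  induction f with
  | _ a b =>
    obtain ⟨hab, htw⟩ := hf
    have hab' : H.C.Adj a b := hab
    have ha := H.isLeaf_of_adj_C hab'
    have hb := H.isLeaf_of_adj_C hab'.symm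
    obtain ⟨u, hu⟩ := ha.exists_adj
    obtain ⟨v, hv⟩ := hb.exists_adj
    have hul := H.not_isLeaf_of_adj ha hu
    have hvl := H.not_isLeaf_of_adj hb hv
    have huv : u ≠ v := by
      rintro rfl
      exact htw ⟨hab', u, hu, hv⟩
    have hnadj : ¬ H.T.Adj u v := by
      intro h
      refine hfree.not_adj_four (a := a) (b := u) (c := v) (d := b) (Or.inl hu) (Or.inl h)
        (Or.inl hv.symm) (Or.inr hab'.symm) ?_ ?_
      · rintro rfl; exact hvl ha
      · rintro rfl; exact hul hb
    have lift : ∀ e ∈ H.innerEdges, ¬ (H.T.deleteEdges {e}).Reachable u v →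
        H.Separates s(a, b) e := by
      intro e he hsep
      refine ⟨a, b, rfl, fun hr => hsep ?_⟩
      have hua : (H.T.deleteEdges {e}).Adj u a := by
        rw [deleteEdges_adj]
        refine ⟨hu.symm, fun h => ?_⟩
        rw [Set.mem_singleton_iff] at h
        exact he.2 a (by simp [← h]) ha
      have hbv : (H.T.deleteEdges {e}).Adj b v := by
        rw [deleteEdges_adj]
        refine ⟨hv, fun h => ?_⟩
        rw [Set.mem_singleton_iff] at h
        exact he.2 b (by simp [← h]) hb
      exact hua.reachable.trans (hr.trans hbv.reachable)
    obtain ⟨x, hux, hx, hsx⟩ := exists_adj_separating H.tree_isTree huv hvl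
    obtain ⟨y, hvy, hy, hsy⟩ := exists_adj_separating H.tree_isTree huv.symm hul
    have hex : s(u, x) ∈ H.innerEdges := ⟨hux, by simp [hul, hx]⟩
    have hey : s(v, y) ∈ H.innerEdges := ⟨hvy, by simp [hvl, hy]⟩
    have hne : s(u, x) ≠ s(v, y) := by
      intro h
      rcases Sym2.eq_iff.1 h with ⟨h, -⟩ | ⟨-, rfl⟩
      · exact huv h
      · exact hnadj hux
    rw [← Set.ncard_pair hne]
    refine Set.ncard_le_ncard ?_ (Set.toFinite _)
    rintro e (rfl | rfl)
    · exact ⟨hex, lift _ hex hsx⟩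
    · exact ⟨hey, lift _ hey fun h => hsy h.symm⟩

/-- A `C₄`-free Halin graph has at most twice as many leaves as inner edges. -/
lemma ncard_leaves_le_two_mul_ncard_innerEdges (hfree : C4Free H.graph) :
    H.leaves.ncard ≤ 2 * H.innerEdges.ncard := by
  classical
  have hcount : (H.C.edgeSet \ H.twinGraph.edgeSet).ncard * 2 ≤ H.innerEdges.ncard * 2 := by
    rw [Set.ncard_eq_toFinset_card', Set.ncard_eq_toFinset_card']
    refine Finset.card_mul_le_card_mul H.Separates ?_ ?_
    · intro f hf
      refine (two_le_ncard_separates hfree (Set.mem_toFinset.1 hf)).trans_eq ?_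
      rw [Set.ncard_eq_toFinset_card']
      congr 1
      ext e
      simp [Finset.bipartiteAbove]
    · intro e he
      refine le_trans ?_ (H.ncard_separates_le_two (Set.mem_toFinset.1 he).1)
      rw [Set.ncard_eq_toFinset_card']
      refine Finset.card_le_card fun f hf => ?_
      simp only [Finset.bipartiteBelow, Finset.mem_filter, Set.mem_toFinset] at hf
      rw [Set.mem_toFinset]
      exact ⟨hf.1.1, hf.2⟩
  have htwin := two_mul_ncard_edgeSet_twinGraph_le hfree
  have hC := H.ncard_edgeSet_C
  have hsplit := Set.le_ncard_sdiff H.twinGraph.edgeSet H.C.edgeSet (Set.toFinite _)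
  omega

end HalinGraph

/-- Upper bound: for every `n ≥ 19`, every `n`-vertex `C₄`-free Halin graph has at
most `5(n-1)/3` edges if `n ≡ 1 (mod 3)`, `5(n-2)/3 + 1` edges if `n ≡ 2 (mod 3)`,
and `5(n-3)/3 + 3` edges if `n ≡ 0 (mod 3)`. -/
theorem halin_turan_C4_upper {V : Type*} [Fintype V] (n : ℕ) (hn : 19 ≤ n)
    (hcard : Fintype.card V = n) (H : HalinGraph V) (hfree : C4Free H.graph) :
    eCount H.graph ≤
      (if n % 3 = 1 then 5 * (n - 1) / 3
      else if n % 3 = 2 then 5 * (n - 2) / 3 + 1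
      else 5 * (n - 3) / 3 + 3) := by
  have hleaf := HalinGraph.ncard_leaves_le_two_mul_ncard_innerEdges hfree
  have hcards := H.ncard_innerEdges_add_ncard_leaves_add_one_le
  have hT := H.ncard_edgeSet_T
  have hC := H.ncard_edgeSet_C
  have he : eCount H.graph ≤ H.T.edgeSet.ncard + H.C.edgeSet.ncard := by
    rw [eCount, HalinGraph.graph, edgeSet_sup]
    exact Set.ncard_union_le _ _
  split_ifs <;> omega
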